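/- arXiv:1902.02409 — 5 statements merged into one kernel-verified Lean document; each statement's English description precedes it below -/
import Mathlib

section
/- Let φ(x,y) be a smooth real-valued function of (x,y) ∈ ℝⁿ × ℝ^d, and let x : ℝ^d → ℝⁿ be a C¹ map such that ∇ₓφ(x(y), y) = 0 for every y. Set φ̃(x,y) = φ(x,y) − φ(x(y),y). Fix k ∈ {1,…,d}, y ∈ ℝ^d, and a convex open set U ⊆ ℝⁿ containing x(y), and suppose that all partial derivatives of φ of total order 2 and 3 in the variables (x₁,…,xₙ, y_k) are bounded in absolute value by Kμ on U × {y}, where K, μ > 0. Then there is a constant C' depending only on n and K such that for all x ∈ U, |∂_{y_k} φ̃(x,y) + ⟨∂_{y_k} x(y), ∇ₓ φ̃(x,y)⟩| ≤ C' μ (1 + |∂_{y_k} x(y)|) |x − x(y)|². -/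
open MeasureTheory Real
open scoped RealInnerProductSpace

noncomputable section

/-- Euclidean space `ℝⁿ`, with the Euclidean norm. -/
abbrev Euc (n : ℕ) : Type := EuclideanSpace ℝ (Fin n)

/-- Directional derivative of `f` in the direction `v`. -/
noncomputable def dirDeriv {E' F : Type*} [NormedAddCommGroup E'] [NormedSpace ℝ E']
    [NormedAddCommGroup F] [NormedSpace ℝ F] (v : E') (f : E' → F) : E' → F :=
  fun x => fderiv ℝ f x v

/-- Iterated directional derivative along a list of directions.  For a multi-index
`γ = (γ₁,…,γₙ)`, the derivative `D^γ f` (up to the harmless unimodular factor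
`(-i)^{|γ|}`, which does not affect absolute values) is `mderiv l f` where `l` is the list
of coordinate directions containing the `i`-th coordinate direction `γᵢ` times; the order
`|γ|` of the multi-index is the length of the list. -/
noncomputable def mderiv {E' F : Type*} [NormedAddCommGroup E'] [NormedSpace ℝ E']
    [NormedAddCommGroup F] [NormedSpace ℝ F] (l : List E') (f : E' → F) : E' → F :=
  l.foldr dirDeriv f

/-- The `i`-th standard basis vector of `ℝⁿ`. -/
noncomputable def eVec (n : ℕ) (i : Fin n) : Euc n := EuclideanSpace.single i 1

/-- The Hessian matrix of second partial derivatives of `φ` at `p`. -/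
noncomputable def hessian {n : ℕ} (φ : Euc n → ℝ) (p : Euc n) : Matrix (Fin n) (Fin n) ℝ :=
  Matrix.of fun i j => mderiv [eVec n i, eVec n j] φ p


section helpers
variable {E : Type*} [NormedAddCommGroup E] [NormedSpace ℝ E]

theorem clm_sum_bound {ι : Type*} [Fintype ι] (u : ι → E) (L : E →ₗ[ℝ] ℝ) (B : ℝ)
    (hB : ∀ i, |L (u i)| ≤ B) (α : ι → ℝ) :
    |L (∑ i, α i • u i)| ≤ B * ∑ i, |α i| := by
  rw [map_sum, Finset.mul_sum]
  refine (Finset.abs_sum_le_sum_abs _ _).trans (Finset.sum_le_sum fun i _ => ?_)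
  rw [map_smul, smul_eq_mul, abs_mul, mul_comm]
  exact mul_le_mul_of_nonneg_right (hB i) (abs_nonneg _)

theorem tri_bound {ι : Type*} [Fintype ι] (u : ι → E) (T : E →L[ℝ] E →L[ℝ] E →L[ℝ] ℝ) (B : ℝ)
    (hB : ∀ i j k, |T (u i) (u j) (u k)| ≤ B) (α β γ : ι → ℝ) :
    |T (∑ i, α i • u i) (∑ i, β i • u i) (∑ i, γ i • u i)| ≤
      B * (∑ i, |γ i|) * (∑ i, |β i|) * (∑ i, |α i|) := by
  have h1 : ∀ i j, |T (u i) (u j) (∑ i, γ i • u i)| ≤ B * ∑ i, |γ i| := fun i j =>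
    clm_sum_bound u (T (u i) (u j)).toLinearMap B (hB i j) γ
  have h2 : ∀ i, |T (u i) (∑ i, β i • u i) (∑ i, γ i • u i)| ≤
      (B * ∑ i, |γ i|) * ∑ i, |β i| := fun i =>
    clm_sum_bound u ((T (u i)).flip (∑ i, γ i • u i)).toLinearMap _ (h1 i) β
  exact clm_sum_bound u ((T.flip (∑ i, β i • u i)).flip (∑ i, γ i • u i)).toLinearMap _ h2 α

theorem mderiv_three (φ : E → ℝ) (hφ : ContDiff ℝ (⊤ : ℕ∞) φ) (a b c p : E) :
    mderiv [a, b, c] φ p = fderiv ℝ (fderiv ℝ (fderiv ℝ φ)) p a b c := by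
  have h1 : ContDiff ℝ (⊤ : ℕ∞) (fderiv ℝ φ) := hφ.fderiv_right (by simp)
  have h2 : ContDiff ℝ (⊤ : ℕ∞) (fderiv ℝ (fderiv ℝ φ)) := h1.fderiv_right (by simp)
  have d1 : Differentiable ℝ (fderiv ℝ φ) := h1.differentiable (by simp)
  have d2 : Differentiable ℝ (fderiv ℝ (fderiv ℝ φ)) := h2.differentiable (by simp)
  have e1 : (fun q => fderiv ℝ (fun r => fderiv ℝ φ r c) q b) =
      fun q => fderiv ℝ (fderiv ℝ φ) q b c := by
    funext q
    rw [(((d1 q).hasFDerivAt).clm_apply (hasFDerivAt_const c q)).fderiv]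
    simp
  show fderiv ℝ (fun q => fderiv ℝ (fun r => fderiv ℝ φ r c) q b) p a = _
  rw [e1, ((((d2 p).hasFDerivAt).clm_apply (hasFDerivAt_const b p)).clm_apply
    (hasFDerivAt_const c p)).fderiv]
  simp

/-- Taylor bound on a segment. -/
theorem taylor_seg (G : E → ℝ) (hG : ContDiff ℝ 2 G) (p h : E) (M : ℝ)
    (h0 : fderiv ℝ G p h = 0)
    (hM : ∀ t ∈ Set.Icc (0:ℝ) 1, |fderiv ℝ (fderiv ℝ G) (p + t • h) h h| ≤ M) :
    |G (p + h) - G p| ≤ M := by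
  have hM0 : 0 ≤ M := (abs_nonneg _).trans (hM 0 (by simp))
  have d0 : Differentiable ℝ G := hG.differentiable (by simp)
  have d1 : Differentiable ℝ (fderiv ℝ G) :=
    (hG.fderiv_right (m := 1) (by norm_num)).differentiable (by simp)
  have hl : ∀ t : ℝ, HasDerivAt (fun t : ℝ => p + t • h) h t := fun t => by
    simpa using ((hasDerivAt_id t).smul_const h).const_add p
  have g0 : ∀ t : ℝ, HasDerivAt (fun t : ℝ => G (p + t • h)) (fderiv ℝ G (p + t • h) h) t :=
    fun t => (d0 _).hasFDerivAt.comp_hasDerivAt t (hl t)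
  have g1 : ∀ t : ℝ, HasDerivAt (fun t : ℝ => fderiv ℝ G (p + t • h) h)
      (fderiv ℝ (fderiv ℝ G) (p + t • h) h h) t := fun t => by
    have := (((d1 _).hasFDerivAt.comp_hasDerivAt t (hl t))).clm_apply (hasDerivAt_const t h)
    simpa using this
  have b1 : ∀ t ∈ Set.Icc (0:ℝ) 1, |fderiv ℝ G (p + t • h) h| ≤ M := by
    intro t ht
    have := norm_image_sub_le_of_norm_deriv_le_segment'
      (fun s _ => (g1 s).hasDerivWithinAt) (C := M) (a := 0) (b := 1)
      (fun s hs => hM s ⟨hs.1, hs.2.le⟩) t ht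
    simp only [zero_smul, add_zero, h0, sub_zero, Real.norm_eq_abs] at this
    exact this.trans (mul_le_of_le_one_right hM0 ht.2)
  have := norm_image_sub_le_of_norm_deriv_le_segment_01'
    (fun s _ => (g0 s).hasDerivWithinAt) (C := M)
    (fun s hs => b1 s ⟨hs.1, hs.2.le⟩)
  simpa using this

/-- coordinate directions -/
noncomputable def uVec (n d : ℕ) (k : Fin d) (o : Option (Fin n)) : Euc n × Euc d :=
  o.elim ((0, eVec d k) : Euc n × Euc d) fun i => (eVec n i, 0)

theorem tri_bound_euc {n d : ℕ} (k : Fin d)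
    (T : (Euc n × Euc d) →L[ℝ] (Euc n × Euc d) →L[ℝ] (Euc n × Euc d) →L[ℝ] ℝ)
    (B : ℝ) (hB0 : 0 ≤ B)
    (hB : ∀ i j l, |T (uVec n d k i) (uVec n d k j) (uVec n d k l)| ≤ B) (h v : Euc n) :
    |T (h, 0) (h, 0) (v, eVec d k)| ≤ B * (1 + n * ‖v‖) * (n * ‖h‖) * (n * ‖h‖) := by
  have sumv : ∀ z : Euc n, z = ∑ i, z i • eVec n i := by
    intro z
    ext j
    simp [eVec, Pi.single_apply]
  have sv : ∀ z : Euc n, ((z, 0) : Euc n × Euc d) = ∑ i, z i • ((eVec n i, 0) : Euc n × Euc d) := by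
    intro z
    have := congrArg (ContinuousLinearMap.inl ℝ (Euc n) (Euc d)) (sumv z)
    rw [map_sum] at this
    simpa using this
  have rep : ∀ (z : Euc n) (c : ℝ), ((z, c • eVec d k) : Euc n × Euc d) =
      ∑ o, (fun o : Option (Fin n) => o.elim c fun i => z i) o • uVec n d k o := by
    intro z c
    rw [Fintype.sum_option]
    simp only [uVec, Option.elim]
    rw [← sv z]
    simp
  have nb : ∀ z : Euc n, ∑ i, |z i| ≤ n * ‖z‖ := by
    intro z
    refine (Finset.sum_le_card_nsmul _ _ ‖z‖ fun i _ => ?_).trans (by simp)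
    exact PiLp.norm_apply_le z i
  have r0 := rep h 0
  rw [zero_smul] at r0
  have r1 := rep v 1
  rw [one_smul] at r1
  have tb := tri_bound (uVec n d k) T B hB (fun o => o.elim 0 fun i => h i)
    (fun o => o.elim 0 fun i => h i) (fun o => o.elim 1 fun i => v i)
  rw [← r0, ← r1] at tb
  refine tb.trans ?_
  simp only [Fintype.sum_option, Option.elim, abs_zero, abs_one, zero_add]
  have := nb h
  have := nb v
  gcongr

end helpers

set_option maxHeartbeats 2000000 in
/-- equation (5) of the paper.  With `φ̃(x,y) = φ(x,y) - φ(x(y),y)`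
one has `∂_{y_k} φ̃(x,y) = -⟨∂_{y_k} x(y), ∇ₓ φ̃(x,y)⟩ + O(μ(1 + |∂_{y_k}x(y)|)|x-x(y)|²)`
on a convex open set `U ∋ x(y)` on which all second and third order partial derivatives
of `φ` in the variables `(x₁,…,xₙ,y_k)` are bounded by `Kμ`; the constant depends only on
`n` and `K`.  (A direction list entry `some i` is the `xᵢ`-direction, `none` is the
`y_k`-direction.) -/
theorem stmt_3 (n d : ℕ) (K : ℝ) (hK : 0 < K) :
    ∃ C' > 0, ∀ φ : Euc n × Euc d → ℝ, ContDiff ℝ (⊤ : ℕ∞) φ →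
      ∀ xf : Euc d → Euc n, ContDiff ℝ 1 xf →
      (∀ y, gradient (fun x => φ (x, y)) (xf y) = 0) →
      ∀ (k : Fin d) (y : Euc d) (U : Set (Euc n)), Convex ℝ U → IsOpen U → xf y ∈ U →
      ∀ μ : ℝ, 0 < μ →
      (∀ l : List (Option (Fin n)), l.length = 2 ∨ l.length = 3 →
        ∀ x ∈ U,
          |mderiv (l.map fun o =>
              o.elim ((0, eVec d k) : Euc n × Euc d) fun i => (eVec n i, 0)) φ (x, y)| ≤
            K * μ) →
      ∀ x ∈ U,
        |fderiv ℝ (fun p : Euc n × Euc d => φ p - φ (xf p.2, p.2)) (x, y)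
              ((0, eVec d k) : Euc n × Euc d) +
            ⟪fderiv ℝ xf y (eVec d k),
              gradient (fun x' => φ (x', y) - φ (xf y, y)) x⟫| ≤
          C' * μ * (1 + ‖fderiv ℝ xf y (eVec d k)‖) * ‖x - xf y‖ ^ 2 := by
  refine ⟨K * (n + 1) ^ 3, by positivity, ?_⟩
  intro φ hφ xf hxf hgrad k y U hU hUo hxU μ hμ hb x hx
  set v := fderiv ℝ xf y (eVec d k) with hv
  set w : Euc n × Euc d := (v, eVec d k) with hw
  have h1 : ContDiff ℝ (⊤ : ℕ∞) (fderiv ℝ φ) := hφ.fderiv_right (by simp)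
  have h2 : ContDiff ℝ (⊤ : ℕ∞) (fderiv ℝ (fderiv ℝ φ)) := h1.fderiv_right (by simp)
  have h2le : (2 : WithTop ℕ∞) ≤ ((⊤ : ℕ∞) : WithTop ℕ∞) := WithTop.coe_le_coe.2 le_top
  have d0 : Differentiable ℝ φ := hφ.differentiable (by simp)
  have d1 : Differentiable ℝ (fderiv ℝ φ) := h1.differentiable (by simp)
  have d2 : Differentiable ℝ (fderiv ℝ (fderiv ℝ φ)) := h2.differentiable (by simp)
  have dx : Differentiable ℝ xf := hxf.differentiable (by simp)
  -- partial derivative in x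
  have px : ∀ (z : Euc n) (y' : Euc d), HasFDerivAt (fun x' => φ (x', y'))
      ((fderiv ℝ φ (z, y')).comp (ContinuousLinearMap.inl ℝ (Euc n) (Euc d))) z := fun z y' =>
    (d0 (z, y')).hasFDerivAt.comp z (hasFDerivAt_prodMk_left z y')
  have crit : ∀ y' h, fderiv ℝ φ (xf y', y') (h, 0) = 0 := by
    intro y' h
    have e : fderiv ℝ (fun x' => φ (x', y')) (xf y') = 0 := by
      have := hgrad y'
      unfold gradient at this
      simpa using this
    rw [(px _ _).fderiv] at e
    simpa using congrArg (fun L => L h) e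
  -- the curve y ↦ (xf y, y)
  have hc : HasFDerivAt (fun y' => (xf y', y'))
      ((fderiv ℝ xf y).prod (ContinuousLinearMap.id ℝ (Euc d))) y :=
    (dx y).hasFDerivAt.prodMk (hasFDerivAt_id y)
  have hess : ∀ h : Euc n, fderiv ℝ (fderiv ℝ φ) (xf y, y) (h, 0) w = 0 := by
    intro h
    have hs : IsSymmSndFDerivAt ℝ φ (xf y, y) :=
      (hφ.contDiffAt (x := (xf y, y))).isSymmSndFDerivAt (by simpa using h2le)
    rw [hs.eq]
    have key : HasFDerivAt (fun y' => fderiv ℝ φ (xf y', y') (h, 0)) _ y :=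
      ((d1 (xf y, y)).hasFDerivAt.comp y (f := fun y' => (xf y', y')) hc).clm_apply (hasFDerivAt_const (h, (0 : Euc d)) y)
    have e0 : (fun y' => fderiv ℝ φ (xf y', y') (h, 0)) = fun _ => (0:ℝ) :=
      funext fun y' => crit y' h
    rw [e0] at key
    have := key.unique (hasFDerivAt_const (0:ℝ) y)
    have := congrArg (fun L => L (eVec d k)) this
    simpa using this
  -- rewrite LHS
  have lhs : fderiv ℝ (fun p : Euc n × Euc d => φ p - φ (xf p.2, p.2)) (x, y)
              ((0, eVec d k) : Euc n × Euc d) +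
            ⟪v, gradient (fun x' => φ (x', y) - φ (xf y, y)) x⟫ =
      fderiv ℝ φ (x, y) w - fderiv ℝ φ (xf y, y) w := by
    have q1 : HasFDerivAt (fun y' => φ (xf y', y')) _ y :=
      (d0 (xf y, y)).hasFDerivAt.comp y (f := fun y' => (xf y', y')) hc
    have q2 : HasFDerivAt (fun p : Euc n × Euc d => φ (xf p.2, p.2)) _ (x, y) :=
      HasFDerivAt.comp (x, y) (f := Prod.snd) q1 hasFDerivAt_snd
    have q3 := (d0 (x, y)).hasFDerivAt.sub q2
    have q4 := (px x y).sub_const (φ (xf y, y))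
    have e3 : fderiv ℝ (fun p : Euc n × Euc d => φ p - φ (xf p.2, p.2)) (x, y) = _ := q3.fderiv
    rw [e3, real_inner_comm, gradient, InnerProductSpace.toDual_symm_apply, q4.fderiv]
    have es : w = (0, eVec d k) + (v, 0) := by simp [hw]
    have : fderiv ℝ φ (x, y) w = fderiv ℝ φ (x, y) (0, eVec d k) + fderiv ℝ φ (x, y) (v, 0) := by
      rw [es, map_add]
    rw [this]
    simp [← hv, ← hw]
    ring
  rw [lhs]
  -- the function G and its derivatives
  set G : Euc n × Euc d → ℝ := fun p => fderiv ℝ φ p w with hGdef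
  have hG : ContDiff ℝ 2 G := (h1.clm_apply contDiff_const).of_le h2le
  have fG : fderiv ℝ G = fun q => (fderiv ℝ (fderiv ℝ φ) q).flip w := by
    funext q
    rw [hGdef, (((d1 q).hasFDerivAt).clm_apply (hasFDerivAt_const w q)).fderiv]
    simp
  have ffG : ∀ q a b, fderiv ℝ (fderiv ℝ G) q a b =
      fderiv ℝ (fderiv ℝ (fderiv ℝ φ)) q a b w := by
    intro q a b
    rw [← mderiv_three φ hφ]
    have dG : Differentiable ℝ (fderiv ℝ G) :=
      (hG.fderiv_right (m := 1) (by norm_num)).differentiable (by simp)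
    show _ = fderiv ℝ (fun q => fderiv ℝ G q b) q a
    rw [(((dG q).hasFDerivAt).clm_apply (hasFDerivAt_const b q)).fderiv]
    simp
  set h := x - xf y with hh
  have hxy : (x, y) = (xf y, y) + ((h, 0) : Euc n × Euc d) := by simp [hh]
  have main := taylor_seg G hG (xf y, y) (h, 0)
    (K * μ * (1 + n * ‖v‖) * (n * ‖h‖) * (n * ‖h‖)) (by rw [fG]; simpa using hess h) ?_
  · rw [← hxy] at main
    refine main.trans ?_
    have hn : (0:ℝ) ≤ n := Nat.cast_nonneg n
    have a1 : 1 + n * ‖v‖ ≤ (n + 1) * (1 + ‖v‖) := by nlinarith [norm_nonneg v]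
    have a2 : (n:ℝ) * n ≤ (n + 1) ^ 2 := by nlinarith
    calc K * μ * (1 + n * ‖v‖) * (n * ‖h‖) * (n * ‖h‖)
        = K * μ * ‖h‖ ^ 2 * ((1 + n * ‖v‖) * (n * n)) := by ring
      _ ≤ K * μ * ‖h‖ ^ 2 * (((n + 1) * (1 + ‖v‖)) * (n + 1) ^ 2) := by gcongr
      _ = _ := by ring
  · intro t ht
    rw [ffG]
    have hz : xf y + t • h ∈ U := by
      have := hU.add_smul_sub_mem hxU hx ht
      simpa [hh] using this
    have hp : (xf y, y) + t • ((h, 0) : Euc n × Euc d) = (xf y + t • h, y) := by simp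
    rw [hp]
    have hB : ∀ i j l, |fderiv ℝ (fderiv ℝ (fderiv ℝ φ)) (xf y + t • h, y) (uVec n d k i)
        (uVec n d k j) (uVec n d k l)| ≤ K * μ := by
      intro i j l
      rw [← mderiv_three φ hφ]
      exact hb [i, j, l] (Or.inr rfl) _ hz
    exact tri_bound_euc k _ (K * μ) (by positivity) hB h v
end
end

section
/- Let μ > 0, K ≥ 1, r > 0, and let φ : ℝⁿ → ℝ be three times continuously differentiable on the ball B_r(x_c) with ∇φ(x_c) = 0, |det Hess φ(x_c)| ≥ μⁿ, and |D^γ φ(x)| ≤ K μ on B_r(x_c) for every multi-index γ with |γ| ∈ {2, 3}. Then there exist constants c > 0 and r' ∈ (0, r], depending only on n, K and r (and not on μ), such that |∇φ(x)| ≥ c μ |x − x_c| for every x ∈ B_{r'}(x_c). -/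
open MeasureTheory Real
open scoped RealInnerProductSpace

noncomputable section

lemma euc_sum {n : ℕ} (w : Euc n) : w = ∑ i, w i • eVec n i := by
  ext j
  simp [eVec, Finset.sum_apply, Pi.single_apply]

lemma euc_coord_le {n : ℕ} (w : Euc n) (i : Fin n) : |w i| ≤ ‖w‖ := by
  simpa using PiLp.norm_apply_le w i

lemma eVec_norm (n : ℕ) (i : Fin n) : ‖eVec n i‖ = 1 := by
  simp [eVec]

lemma euc_norm_le_sum {n : ℕ} (w : Euc n) : ‖w‖ ≤ ∑ i, |w i| := by
  conv_lhs => rw [euc_sum w]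
  refine (norm_sum_le _ _).trans (Finset.sum_le_sum fun i _ => ?_)
  rw [norm_smul, eVec_norm, mul_one, Real.norm_eq_abs]

lemma clm_norm_le {n : ℕ} (L : Euc n →L[ℝ] ℝ) (C : ℝ) (hC : 0 ≤ C)
    (h : ∀ i, |L (eVec n i)| ≤ C) : ‖L‖ ≤ n * C := by
  refine L.opNorm_le_bound (by positivity) fun w => ?_
  have h1 : L w = ∑ i, w i * L (eVec n i) := by
    conv_lhs => rw [euc_sum w]
    simp [map_sum]
  rw [h1]
  refine (norm_sum_le _ _).trans ?_
  calc ∑ i, ‖w i * L (eVec n i)‖ ≤ ∑ _i : Fin n, ‖w‖ * C := by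
        refine Finset.sum_le_sum fun i _ => ?_
        rw [norm_mul, Real.norm_eq_abs, Real.norm_eq_abs]
        exact mul_le_mul (euc_coord_le w i) (h i) (abs_nonneg _) (norm_nonneg _)
    _ = n * C * ‖w‖ := by simp; ring

lemma dirDeriv_contDiffOn {n : ℕ} {f : Euc n → ℝ} {s : Set (Euc n)} (hs : IsOpen s) {m k : ℕ}
    (hf : ContDiffOn ℝ k f s) (hmk : m + 1 ≤ k) (v : Euc n) : ContDiffOn ℝ m (dirDeriv v f) s := by
  have := hf.fderiv_of_isOpen hs (m := m) (by exact_mod_cast hmk)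
  exact this.clm_apply contDiffOn_const

/-- Lower bound for a matrix with bounded entries and determinant at least one. -/
lemma vecMul_lower {n : ℕ} (A : Matrix (Fin n) (Fin n) ℝ) (K : ℝ) (hK : 1 ≤ K)
    (hA : ∀ i j, |A i j| ≤ K) (hd : 1 ≤ |A.det|) (v : Fin n → ℝ) (T : ℝ)
    (hT : ∀ j, |Matrix.vecMul v A j| ≤ T) (j : Fin n) :
    |v j| ≤ n * (T * (n.factorial * K ^ n)) := by
  have hadj : ∀ i j, |A.adjugate i j| ≤ n.factorial * K ^ n := by
    intro i j
    rw [Matrix.adjugate_apply]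
    have := Matrix.det_le (A := A.updateRow j (Pi.single i 1)) (abv := AbsoluteValue.abs) (x := K) ?_
    · simpa [nsmul_eq_mul] using this
    · intro a b
      rw [Matrix.updateRow_apply]
      split_ifs
      · by_cases hb : b = i
        · subst hb; simpa using hK
        · simp [hb]; linarith
      · exact hA a b
  have h1 : Matrix.vecMul (Matrix.vecMul v A) A.adjugate = A.det • v := by
    rw [Matrix.vecMul_vecMul, Matrix.mul_adjugate, Matrix.vecMul_smul, Matrix.vecMul_one]
  have h2 : A.det * v j = ∑ i, Matrix.vecMul v A i * A.adjugate i j := by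
    have := congrFun h1 j
    simp only [Pi.smul_apply, smul_eq_mul] at this
    rw [← this]; rfl
  calc |v j| ≤ |A.det| * |v j| := le_mul_of_one_le_left (abs_nonneg _) hd
    _ = |∑ i, Matrix.vecMul v A i * A.adjugate i j| := by rw [← abs_mul, h2]
    _ ≤ ∑ i, |Matrix.vecMul v A i * A.adjugate i j| := Finset.abs_sum_le_sum_abs _ _
    _ ≤ ∑ _i : Fin n, T * (n.factorial * K ^ n) := by
        refine Finset.sum_le_sum fun i _ => ?_
        rw [abs_mul]
        exact mul_le_mul (hT i) (hadj i j) (abs_nonneg _) ((abs_nonneg _).trans (hT i))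
    _ = _ := by simp

lemma fderiv_le_gradient {n : ℕ} (φ : Euc n → ℝ) (x : Euc n) (i : Fin n) :
    |dirDeriv (eVec n i) φ x| ≤ ‖gradient φ x‖ := by
  have h1 : ‖gradient φ x‖ = ‖fderiv ℝ φ x‖ := by simp [gradient]
  rw [h1]
  have := (fderiv ℝ φ x).le_opNorm (eVec n i)
  rwa [eVec_norm, mul_one] at this

/-- gradient lower bound near a non-degenerate critical point to scale
`μ`.  If `φ` is `C³` on `B_r(x_c)`, `∇φ(x_c) = 0`, `|det Hess φ(x_c)| ≥ μⁿ` and all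
second and third order partial derivatives are bounded by `Kμ` on the ball, then
`|∇φ(x)| ≥ c μ |x - x_c|` on a smaller ball `B_{r'}(x_c)`, where `c > 0` and
`0 < r' ≤ r` depend only on `n`, `K` and `r` (not on `μ`). -/
theorem stmt_4 (n : ℕ) (K r : ℝ) (hK : 1 ≤ K) (hr : 0 < r) :
    ∃ c > 0, ∃ r' : ℝ, 0 < r' ∧ r' ≤ r ∧
      ∀ μ : ℝ, 0 < μ → ∀ (φ : Euc n → ℝ) (x_c : Euc n),
        ContDiffOn ℝ 3 φ (Metric.ball x_c r) →
        gradient φ x_c = 0 →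
        μ ^ n ≤ |(hessian φ x_c).det| →
        (∀ l : List (Fin n), l.length = 2 ∨ l.length = 3 →
          ∀ x ∈ Metric.ball x_c r, |mderiv (l.map (eVec n)) φ x| ≤ K * μ) →
        ∀ x ∈ Metric.ball x_c r', c * μ * ‖x - x_c‖ ≤ ‖gradient φ x‖ := by
  set M : ℝ := n.factorial * K ^ n with hM
  have hM0 : 0 ≤ M := by positivity
  set C : ℝ := n * (n * M) + 1 with hC
  have hC0 : 0 < C := by positivity
  set B : ℝ := n * (n * K) + 1 with hB
  have hB0 : 0 < B := by positivity
  refine ⟨1 / (2 * C), by positivity, min r (1 / (2 * C * B)), by positivity, min_le_left _ _, ?_⟩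
  intro μ hμ φ p hφ hgrad hdet hbd x hx
  have hKμ : 0 ≤ K * μ := by positivity
  have hxr : ‖x - p‖ < r := by
    rw [mem_ball_iff_norm] at hx; exact hx.trans_le (min_le_left _ _)
  have hxs : ‖x - p‖ < 1 / (2 * C * B) := by
    rw [mem_ball_iff_norm] at hx; exact hx.trans_le (min_le_right _ _)
  set d := ‖x - p‖ with hd
  have hd0 : 0 ≤ d := norm_nonneg _
  set G := ‖gradient φ x‖ with hG
  have hsub : Metric.closedBall p d ⊆ Metric.ball p r := Metric.closedBall_subset_ball hxr
  have hpd : p ∈ Metric.closedBall p d := Metric.mem_closedBall_self hd0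
  have hxd : x ∈ Metric.closedBall p d := by rw [mem_closedBall_iff_norm]
  have hcv : Convex ℝ (Metric.closedBall p d) := convex_closedBall _ _
  have hg2 : ∀ j, ContDiffOn ℝ (2 : ℕ) (dirDeriv (eVec n j) φ) (Metric.ball p r) := fun j =>
    dirDeriv_contDiffOn Metric.isOpen_ball (k := 3) (by exact_mod_cast hφ) (by norm_num) _
  have hg1 : ∀ i j, ContDiffOn ℝ (1 : ℕ) (dirDeriv (eVec n i) (dirDeriv (eVec n j) φ))
      (Metric.ball p r) := fun i j =>
    dirDeriv_contDiffOn Metric.isOpen_ball (k := 2) (hg2 j) (by norm_num) _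
  have hda : ∀ {f : Euc n → ℝ} {k : ℕ}, ContDiffOn ℝ k f (Metric.ball p r) → k ≠ 0 →
      ∀ y ∈ Metric.closedBall p d, DifferentiableAt ℝ f y := by
    intro f k hf hk y hy
    exact (hf.differentiableOn (by exact_mod_cast hk)).differentiableAt
      (Metric.isOpen_ball.mem_nhds (hsub hy))
  -- second derivatives are Lipschitz
  have hlip : ∀ i j, ∀ y ∈ Metric.closedBall p d,
      |dirDeriv (eVec n i) (dirDeriv (eVec n j) φ) y
        - dirDeriv (eVec n i) (dirDeriv (eVec n j) φ) p| ≤ n * (K * μ) * d := by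
    intro i j y hy
    have := hcv.norm_image_sub_le_of_norm_fderiv_le (𝕜 := ℝ) (C := n * (K * μ))
      (hda (hg1 i j) one_ne_zero) (fun z hz => clm_norm_le _ _ hKμ fun k =>
        hbd [k, i, j] (Or.inr rfl) z (hsub hz)) hpd hy
    rw [Real.norm_eq_abs] at this
    refine this.trans (mul_le_mul_of_nonneg_left ?_ (by positivity))
    rwa [mem_closedBall_iff_norm] at hy
  have htay : ∀ j, |dirDeriv (eVec n j) φ x - fderiv ℝ (dirDeriv (eVec n j) φ) p (x - p)|
      ≤ n * (n * (K * μ) * d) * d := by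
    intro j
    have := hcv.norm_image_sub_le_of_norm_fderiv_le' (𝕜 := ℝ) (C := n * (n * (K * μ) * d))
      (φ := fderiv ℝ (dirDeriv (eVec n j) φ) p)
      (hda (hg2 j) two_ne_zero) (fun z hz => clm_norm_le _ _ (by positivity) fun i =>
        hlip i j z hz) hpd hxd
    have h0 : dirDeriv (eVec n j) φ p = 0 := by
      have := fderiv_le_gradient φ p j
      rw [hgrad, norm_zero] at this
      exact abs_nonpos_iff.mp this
    rwa [h0, sub_zero, Real.norm_eq_abs] at this
  set A : Matrix (Fin n) (Fin n) ℝ := μ⁻¹ • hessian φ p with hA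
  have hAb : ∀ i j, |A i j| ≤ K := by
    intro i j
    have := hbd [i, j] (Or.inl rfl) p (hsub hpd)
    have h2 : A i j = μ⁻¹ * mderiv ([i, j].map (eVec n)) φ p := rfl
    rw [h2, abs_mul, abs_of_pos (inv_pos.mpr hμ), inv_mul_le_iff₀ hμ]
    linarith
  have hAd : 1 ≤ |A.det| := by
    rw [hA, Matrix.det_smul, Fintype.card_fin, abs_mul, abs_of_pos (by positivity), inv_pow,
      le_inv_mul_iff₀ (by positivity), mul_one]
    exact hdet
  have hAv : ∀ j, Matrix.vecMul (fun i => (x - p) i) A j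
      = μ⁻¹ * fderiv ℝ (dirDeriv (eVec n j) φ) p (x - p) := by
    intro j
    have h1 : fderiv ℝ (dirDeriv (eVec n j) φ) p (x - p)
        = ∑ i, (x - p) i * hessian φ p i j := by
      conv_lhs => rw [euc_sum (x - p)]
      simp only [map_sum, map_smul, smul_eq_mul]
      rfl
    rw [h1, Finset.mul_sum]
    change ∑ i, (x - p) i * A i j = _
    refine Finset.sum_congr rfl fun i _ => ?_
    change (x - p) i * (μ⁻¹ * hessian φ p i j) = _
    ring
  have hT : ∀ j, |Matrix.vecMul (fun i => (x - p) i) A j| ≤ μ⁻¹ * G + B * d * d := by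
    intro j
    rw [hAv, abs_mul, abs_of_pos (inv_pos.mpr hμ)]
    have h1 := abs_le.mp (htay j)
    have h2 := abs_le.mp (fderiv_le_gradient φ x j)
    have h3 : |fderiv ℝ (dirDeriv (eVec n j) φ) p (x - p)| ≤ G + n * (n * (K * μ) * d) * d := by
      rw [abs_le]; constructor <;> linarith [h1.1, h1.2, h2.1, h2.2]
    have h4 := mul_le_mul_of_nonneg_left h3 (inv_pos.mpr hμ).le
    have h5 : μ⁻¹ * (G + n * (n * (K * μ) * d) * d) = μ⁻¹ * G + (n * (n * K)) * d * d := by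
      field_simp
    rw [h5] at h4
    have : 0 ≤ d * d := by positivity
    rw [hB]; nlinarith
  have hv := vecMul_lower A K hK hAb hAd (fun i => (x - p) i) _ hT
  have hsum : d ≤ n * (n * ((μ⁻¹ * G + B * d * d) * M)) := by
    refine (euc_norm_le_sum (x - p)).trans ((Finset.sum_le_sum fun i _ => hv i).trans ?_)
    simp [hM]
  have hT0 : 0 ≤ μ⁻¹ * G + B * d * d := by positivity
  have h6 : d ≤ C * (μ⁻¹ * G + B * d * d) := by rw [hC]; nlinarith
  have h7 : C * B * d ≤ 1 / 2 := by
    rw [lt_div_iff₀ (by positivity)] at hxs; nlinarith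
  have h8 : d ≤ 2 * C * (μ⁻¹ * G) := by nlinarith
  have h9 : μ * d ≤ 2 * C * G := by
    have := mul_le_mul_of_nonneg_left h8 hμ.le
    have e : μ * (2 * C * (μ⁻¹ * G)) = 2 * C * G := by field_simp
    rwa [e] at this
  rw [mul_assoc, one_div, inv_mul_le_iff₀ (by positivity)]
  exact h9
end
end

section
/- Let A be a real symmetric n×n matrix, and let K, μ > 0 be such that |A_{ij}| ≤ K μ for all i, j and |det A| ≥ μⁿ. Then every eigenvalue λ of A satisfies |λ| ≥ (nK)^{-(n−1)} μ, and consequently ‖A v‖ ≥ (nK)^{-(n−1)} μ ‖v‖ for every v ∈ ℝⁿ. -/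
open MeasureTheory Real
open scoped RealInnerProductSpace

noncomputable section

/-- A real symmetric matrix with entries bounded by `Kμ` and
`|det A| ≥ μⁿ` has all eigenvalues of absolute value at least `(nK)^{-(n-1)} μ`, and
consequently `‖Av‖ ≥ (nK)^{-(n-1)} μ ‖v‖` for every vector `v` (Euclidean norms). -/
theorem stmt_5 (n : ℕ) (A : Matrix (Fin n) (Fin n) ℝ) (K μ : ℝ) (hK : 0 < K)
    (hμ : 0 < μ) (hsymm : A.IsSymm) (hbd : ∀ i j, |A i j| ≤ K * μ)
    (hdet : μ ^ n ≤ |A.det|) :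
    (∀ t : ℝ, Module.End.HasEigenvalue (Matrix.toEuclideanLin A) t →
      (((n : ℝ) * K) ^ (n - 1))⁻¹ * μ ≤ |t|) ∧
    ∀ v : Euc n,
      (((n : ℝ) * K) ^ (n - 1))⁻¹ * μ * ‖v‖ ≤ ‖Matrix.toEuclideanLin A v‖ := by
  have hA : A.IsHermitian := by
    ext i j
    simpa using hsymm.apply i j
  set b := hA.eigenvectorBasis with hb
  have hev : ∀ i, Matrix.toEuclideanLin A (b i) = hA.eigenvalues i • b i := by
    intro i
    have h := hA.mulVec_eigenvectorBasis i
    ext k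
    have := congrFun h k
    simpa [Matrix.toLpLin_apply] using this
  have hub : ∀ i, |hA.eigenvalues i| ≤ (n : ℝ) * K * μ := by
    intro i
    have : Nonempty (Fin n) := ⟨i⟩
    obtain ⟨k, hk⟩ := Finite.exists_max (fun j => |(b i) j|)
    have hne : b i ≠ 0 := b.orthonormal.ne_zero i
    have hpos : 0 < |(b i) k| := by
      by_contra hcon
      apply hne
      ext j
      have := hk j
      have h0 : |(b i) j| ≤ 0 := by linarith
      simpa using abs_nonpos_iff.mp h0
    have h1 : ∑ j, A k j * (b i) j = hA.eigenvalues i * (b i) k := by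
      have := congrArg (fun w : Euc n => w k) (hev i)
      simpa [Matrix.toLpLin_apply, Matrix.mulVec, dotProduct] using this
    have h2 : |hA.eigenvalues i| * |(b i) k| ≤ (n : ℝ) * K * μ * |(b i) k| := by
      rw [← abs_mul, ← h1]
      calc |∑ j, A k j * (b i) j| ≤ ∑ j, |A k j * (b i) j| := Finset.abs_sum_le_sum_abs _ _
        _ ≤ ∑ _j : Fin n, (K * μ) * |(b i) k| := by
            refine Finset.sum_le_sum fun j _ => ?_
            rw [abs_mul]
            exact mul_le_mul (hbd k j) (hk j) (abs_nonneg _) (by positivity)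
        _ = (n : ℝ) * K * μ * |(b i) k| := by simp; ring
    exact le_of_mul_le_mul_right h2 hpos
  have hlb : ∀ i, (((n : ℝ) * K) ^ (n - 1))⁻¹ * μ ≤ |hA.eigenvalues i| := by
    intro i
    have hn : 0 < n := i.pos
    have hn' : (0 : ℝ) < n := by exact_mod_cast hn
    have hd : |A.det| = ∏ j, |hA.eigenvalues j| := by
      rw [hA.det_eq_prod_eigenvalues, ← Finset.abs_prod]
      simp
    rw [hd, ← Finset.mul_prod_erase _ _ (Finset.mem_univ i)] at hdet
    have h3 : ∏ j ∈ Finset.univ.erase i, |hA.eigenvalues j| ≤ ((n : ℝ) * K * μ) ^ (n - 1) := by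
      refine (Finset.prod_le_prod (fun j _ => abs_nonneg _) (fun j _ => hub j)).trans ?_
      simp
    have h4 : μ ^ n ≤ |hA.eigenvalues i| * ((n : ℝ) * K * μ) ^ (n - 1) :=
      hdet.trans (mul_le_mul_of_nonneg_left h3 (abs_nonneg _))
    have h5 : μ ^ n = μ * μ ^ (n - 1) := by
      rw [← pow_succ', Nat.sub_add_cancel hn]
    rw [h5, mul_pow, ← mul_assoc] at h4
    have h6 := le_of_mul_le_mul_right h4 (by positivity)
    rw [inv_mul_le_iff₀ (by positivity)]
    linarith
  have hmain : ∀ v : Euc n,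
      (((n : ℝ) * K) ^ (n - 1))⁻¹ * μ * ‖v‖ ≤ ‖Matrix.toEuclideanLin A v‖ := by
    intro v
    have hc : 0 ≤ (((n : ℝ) * K) ^ (n - 1))⁻¹ * μ := by positivity
    have hs : (Matrix.toEuclideanLin A).IsSymmetric := Matrix.isHermitian_iff_isSymmetric.mp hA
    refine (pow_le_pow_iff_left₀ (by positivity) (norm_nonneg _) two_ne_zero).mp ?_
    rw [mul_pow, ← b.sum_sq_norm_inner_right v, ← b.sum_sq_norm_inner_right, Finset.mul_sum]
    refine Finset.sum_le_sum fun i _ => ?_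
    rw [← hs, hev, real_inner_smul_left, norm_mul, mul_pow ‖hA.eigenvalues i‖]
    refine mul_le_mul_of_nonneg_right ?_ (sq_nonneg _)
    exact pow_le_pow_left₀ hc (hlb i) 2
  refine ⟨fun t ht => ?_, hmain⟩
  obtain ⟨v, hv⟩ := ht.exists_hasEigenvector
  have h := hmain v
  rw [hv.apply_eq_smul, norm_smul] at h
  exact le_of_mul_le_mul_right h (norm_pos_iff.mpr hv.2)
end
end

section
/- Let 0 < α < 1/2 and λ ≥ 1. Suppose a(λ,·) : ℝ → ℂ is smooth, supported in {x ∈ ℝ : λ^{-α} ≤ |x| ≤ 1}, and satisfies |∂ₓ^k a(λ,x)| ≤ C_k λ^{αk} for every natural number k, with constants C_k independent of λ and x. Then for every natural number N there is a constant C_N, independent of λ, such that |∫_ℝ e^{iλx²} a(λ,x) dx| ≤ C_N λ^{-N(1−2α)}. -/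
open MeasureTheory Real

noncomputable section

/-- The region in which the amplitudes are supported. -/
def annS (r : ℝ) : Set ℝ := {x : ℝ | r ≤ |x| ∧ |x| ≤ 1}

lemma annS_closed (r : ℝ) : IsClosed (annS r) :=
  (isClosed_le continuous_const continuous_abs).inter
    (isClosed_le continuous_abs continuous_const)

lemma annS_sub (r : ℝ) : annS r ⊆ Set.Icc (-1) 1 := fun _ hx => abs_le.mp hx.2

lemma supp_deriv {S : Set ℝ} (hS : IsClosed S) {f : ℝ → ℂ}
    (hf : Function.support f ⊆ S) : Function.support (deriv f) ⊆ S :=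
  support_deriv_subset.trans (closure_minimal hf hS)

lemma supp_iter {S : Set ℝ} (hS : IsClosed S) {f : ℝ → ℂ}
    (hf : Function.support f ⊆ S) (k : ℕ) : Function.support (iteratedDeriv k f) ⊆ S := by
  induction k with
  | zero => simpa using hf
  | succ k ih => rw [iteratedDeriv_succ]; exact supp_deriv hS ih

lemma quot_smooth {r : ℝ} (hr : 0 < r) {b : ℝ → ℂ} (hb : ContDiff ℝ (⊤ : ℕ∞) b)
    (hs : Function.support b ⊆ annS r) : ContDiff ℝ (⊤ : ℕ∞) (fun x : ℝ => b x / (x : ℂ)) := by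
  rw [contDiff_iff_contDiffAt]
  intro x
  by_cases hx : x = 0
  · subst hx
    have : (fun x : ℝ => b x / (x : ℂ)) =ᶠ[nhds 0] fun _ => 0 := by
      filter_upwards [Metric.ball_mem_nhds (0 : ℝ) hr] with y hy
      have : b y = 0 := by
        by_contra h
        have h1 := (hs h).1
        simp at hy
        linarith
      simp [this]
    exact contDiffAt_const.congr_of_eventuallyEq this
  · have h1 : ContDiffAt ℝ (⊤ : ℕ∞) (fun x : ℝ => (x : ℂ)) x :=
      Complex.ofRealCLM.contDiff.contDiffAt
    have h2 : (x : ℂ) ≠ 0 := by exact_mod_cast hx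
    have h3 := hb.contDiffAt.mul (h1.inv h2)
    simp only [div_eq_mul_inv]
    exact h3

lemma quot_supp {S : Set ℝ} {b : ℝ → ℂ} (hs : Function.support b ⊆ S) :
    Function.support (fun x : ℝ => b x / (x : ℂ)) ⊆ S := by
  intro x hx
  apply hs
  intro h
  apply hx
  simp [h]

lemma iter_mul {c : ℝ → ℂ} (hc : ContDiff ℝ (⊤ : ℕ∞) c) (k : ℕ) :
    iteratedDeriv (k + 1) (fun x : ℝ => (x : ℂ) * c x) =
      fun x : ℝ => (x : ℂ) * iteratedDeriv (k + 1) c x + ((k : ℂ) + 1) * iteratedDeriv k c x := by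
  have hd : ∀ (j : ℕ) (x : ℝ), HasDerivAt (iteratedDeriv j c) (iteratedDeriv (j + 1) c x) x := by
    intro j x
    rw [iteratedDeriv_succ]
    exact ((hc.differentiable_iteratedDeriv j (by exact_mod_cast WithTop.coe_lt_top _)) x).hasDerivAt
  have hx : ∀ x : ℝ, HasDerivAt (fun x : ℝ => (x : ℂ)) 1 x := fun x => Complex.ofRealCLM.hasDerivAt
  induction k with
  | zero =>
    funext x
    rw [iteratedDeriv_succ, iteratedDeriv_zero]
    have := (hx x).mul (hd 0 x)
    simp only [iteratedDeriv_zero] at this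
    refine (HasDerivAt.deriv this).trans ?_
    simp; ring
  | succ k ih =>
    rw [iteratedDeriv_succ, ih]
    funext x
    have := ((hx x).mul (hd (k + 1) x)).add ((hd k x).const_mul ((k : ℂ) + 1))
    refine (HasDerivAt.deriv this).trans ?_
    push_cast; ring

lemma ibp {r L : ℝ} (hr : 0 < r) {b : ℝ → ℂ} (hb : ContDiff ℝ (⊤ : ℕ∞) b)
    (hs : Function.support b ⊆ annS r) :
    (2 * Complex.I * L) * ∫ x : ℝ, Complex.exp (Complex.I * L * x ^ 2) * b x =
      - ∫ x : ℝ, Complex.exp (Complex.I * L * x ^ 2) * deriv (fun x : ℝ => b x / (x : ℂ)) x := by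
  set c : ℝ → ℂ := fun x : ℝ => b x / (x : ℂ) with hcdef
  have hc : ContDiff ℝ (⊤ : ℕ∞) c := quot_smooth hr hb hs
  have hcs : Function.support c ⊆ annS r := quot_supp hs
  have hcont : Continuous (fun x : ℝ => Complex.exp (Complex.I * L * x ^ 2)) := by fun_prop
  have hint : ∀ f : ℝ → ℂ, Continuous f → Function.support f ⊆ annS r →
      Integrable (fun x : ℝ => Complex.exp (Complex.I * L * x ^ 2) * f x) := by
    intro f hf hfs
    apply (hcont.mul hf).integrable_of_hasCompactSupport
    apply HasCompactSupport.mul_left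
    exact HasCompactSupport.of_support_subset_isCompact isCompact_Icc (hfs.trans (annS_sub r))
  have hc' : Continuous (deriv c) := hc.continuous_deriv (by exact_mod_cast le_top)
  have hi1 := hint b hb.continuous hs
  have hi2 := hint c hc.continuous hcs
  have hi3 := hint _ hc' (supp_deriv (annS_closed r) hcs)
  have hder : ∀ x : ℝ, HasDerivAt (fun x : ℝ => Complex.exp (Complex.I * L * x ^ 2) * c x)
      ((2 * Complex.I * L) * (Complex.exp (Complex.I * L * x ^ 2) * b x) +
        Complex.exp (Complex.I * L * x ^ 2) * deriv c x) x := by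
    intro x
    have hx : HasDerivAt (fun x : ℝ => (x : ℂ)) 1 x := Complex.ofRealCLM.hasDerivAt
    have h1 := (((hx.pow 2).const_mul (Complex.I * L)).cexp).mul
      (((hc.differentiable (by simp)) x).hasDerivAt)
    refine h1.congr_deriv ?_
    have hbx : b x = x * c x := by
      by_cases h0 : x = 0
      · subst h0
        by_contra h
        have hb0 : b 0 ≠ 0 := by simpa using h
        have := (hs hb0).1
        simp at this
        linarith
      · have : (x : ℂ) ≠ 0 := by exact_mod_cast h0
        simp only [hcdef]; field_simp
    rw [hbx]
    simp
    ring
  have hz := integral_eq_zero_of_hasDerivAt_of_integrable hder ((hi1.const_mul _).add hi3) hi2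
  rw [integral_add (hi1.const_mul _) hi3, integral_const_mul] at hz
  exact eq_neg_of_add_eq_zero_left hz

lemma quot_bd (α : ℝ) (a : ℝ → ℝ → ℂ)
    (ha_smooth : ∀ lam ≥ (1 : ℝ), ContDiff ℝ (⊤ : ℕ∞) (a lam))
    (ha_supp : ∀ lam ≥ (1 : ℝ), Function.support (a lam) ⊆ annS (lam ^ (-α)))
    (ha_bd : ∀ k : ℕ, ∃ C > 0, ∀ lam ≥ (1 : ℝ), ∀ x : ℝ,
      ‖iteratedDeriv k (a lam) x‖ ≤ C * (lam ^ α) ^ k) (k : ℕ) :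
    ∃ C > 0, ∀ lam ≥ (1 : ℝ), ∀ x : ℝ,
      ‖iteratedDeriv k (fun x : ℝ => a lam x / (x : ℂ)) x‖ ≤ C * (lam ^ α) ^ (k + 1) := by
  -- it suffices to bound `x` times the derivative
  have red : ∀ (k : ℕ) (C : ℝ), 0 < C → (∀ lam ≥ (1 : ℝ), ∀ x : ℝ,
      ‖(x : ℂ) * iteratedDeriv k (fun x : ℝ => a lam x / (x : ℂ)) x‖ ≤ C * (lam ^ α) ^ k) →
      ∃ C > 0, ∀ lam ≥ (1 : ℝ), ∀ x : ℝ,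
      ‖iteratedDeriv k (fun x : ℝ => a lam x / (x : ℂ)) x‖ ≤ C * (lam ^ α) ^ (k + 1) := by
    intro k C hC h
    refine ⟨C, hC, fun lam hl x => ?_⟩
    have hm : 0 < lam ^ α := Real.rpow_pos_of_pos (by linarith) _
    by_cases hx : x ∈ annS (lam ^ (-α))
    · have h1 := h lam hl x
      rw [norm_mul, Complex.norm_real, Real.norm_eq_abs] at h1
      have h2 := hx.1
      rw [Real.rpow_neg (by linarith)] at h2
      have h3 : 1 ≤ lam ^ α * |x| := by
        have := mul_le_mul_of_nonneg_left h2 hm.le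
        rwa [mul_inv_cancel₀ hm.ne'] at this
      set D := ‖iteratedDeriv k (fun x : ℝ => a lam x / (x : ℂ)) x‖
      have hD : 0 ≤ D := norm_nonneg _
      calc D ≤ (lam ^ α * |x|) * D := le_mul_of_one_le_left hD h3
        _ = lam ^ α * (|x| * D) := by ring
        _ ≤ lam ^ α * (C * (lam ^ α) ^ k) := mul_le_mul_of_nonneg_left h1 hm.le
        _ = _ := by ring
    · have h0 : iteratedDeriv k (fun x : ℝ => a lam x / (x : ℂ)) x = 0 := by
        by_contra h
        exact hx (supp_iter (annS_closed _) (quot_supp (ha_supp lam hl)) k h)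
      rw [h0, norm_zero]; positivity
  have hmul : ∀ lam ≥ (1 : ℝ), (fun x : ℝ => (x : ℂ) * (a lam x / (x : ℂ))) = a lam := by
    intro lam hl
    funext x
    by_cases h0 : x = 0
    · subst h0
      by_contra h
      have hb0 : a lam 0 ≠ 0 := fun h' => h (by simp [h'])
      have := (ha_supp lam hl hb0).1
      have hp : 0 < lam ^ (-α) := Real.rpow_pos_of_pos (by linarith) _
      simp at this
      linarith
    · have : (x : ℂ) ≠ 0 := by exact_mod_cast h0
      field_simp
  induction k with
  | zero =>
    obtain ⟨C, hC, h⟩ := ha_bd 0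
    refine red 0 C hC fun lam hl x => ?_
    have := h lam hl x
    rw [iteratedDeriv_zero] at this ⊢
    rwa [← congrFun (hmul lam hl) x] at this
  | succ k ih =>
    obtain ⟨C, hC, h⟩ := ha_bd (k + 1)
    obtain ⟨D, hD, h'⟩ := ih
    refine red (k + 1) (C + (k + 1) * D) (by positivity) fun lam hl x => ?_
    have h1 := h lam hl x
    have h2 := h' lam hl x
    have e := iter_mul (quot_smooth (Real.rpow_pos_of_pos (by linarith) _)
      (ha_smooth lam hl) (ha_supp lam hl)) k
    rw [hmul lam hl] at e
    have e' := congrFun e x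
    rw [← sub_eq_iff_eq_add.mpr e']
    refine (norm_sub_le _ _).trans ?_
    have h3 : ‖((k : ℂ) + 1)‖ = (k : ℝ) + 1 := by
      exact_mod_cast Complex.norm_natCast (k + 1)
    rw [norm_mul, h3, add_mul]
    have : ((k : ℝ) + 1) * ‖iteratedDeriv k (fun x : ℝ => a lam x / (x : ℂ)) x‖ ≤
      ((k : ℝ) + 1) * (D * (lam ^ α) ^ (k + 1)) := by gcongr
    linarith

lemma main_aux (α : ℝ) (N : ℕ) : ∀ (a : ℝ → ℝ → ℂ)
    (_ : ∀ lam ≥ (1 : ℝ), ContDiff ℝ (⊤ : ℕ∞) (a lam))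
    (_ : ∀ lam ≥ (1 : ℝ), Function.support (a lam) ⊆ annS (lam ^ (-α)))
    (_ : ∀ k : ℕ, ∃ C > 0, ∀ lam ≥ (1 : ℝ), ∀ x : ℝ,
      ‖iteratedDeriv k (a lam) x‖ ≤ C * (lam ^ α) ^ k),
    ∃ C_N > 0, ∀ lam ≥ (1 : ℝ),
      ‖∫ x : ℝ, Complex.exp (Complex.I * lam * x ^ 2) * a lam x‖ ≤
        C_N * lam ^ (-(N : ℝ) * (1 - 2 * α)) := by
  induction N with
  | zero =>
    intro a _ hs hb
    obtain ⟨C, hC, h⟩ := hb 0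
    refine ⟨C * 2, by positivity, fun lam hl => ?_⟩
    have hsup : Function.support (fun x : ℝ => Complex.exp (Complex.I * lam * x ^ 2) * a lam x) ⊆
        Set.Icc (-1) 1 := by
      intro x hx
      exact annS_sub _ (hs lam hl (right_ne_zero_of_mul hx))
    rw [← setIntegral_eq_integral_of_forall_compl_eq_zero (s := Set.Icc (-1) 1)
      (fun x hx => by by_contra h; exact hx (hsup h))]
    have := norm_setIntegral_le_of_norm_le_const (μ := volume) (s := Set.Icc (-1 : ℝ) 1) (C := C)
      (f := fun x : ℝ => Complex.exp (Complex.I * lam * x ^ 2) * a lam x) (by simp) (by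
        intro x _
        have h1 := h lam hl x
        have h2 : ‖Complex.exp (Complex.I * lam * x ^ 2)‖ = 1 := by
          have : Complex.I * lam * x ^ 2 = ((lam * x ^ 2 : ℝ) : ℂ) * Complex.I := by
            push_cast; ring
          rw [this, Complex.norm_exp_ofReal_mul_I]
        rw [norm_mul, h2]
        simpa using h1)
    refine this.trans (le_of_eq ?_)
    simp [Measure.real]
    norm_num
  | succ N ih =>
    intro a hsm hs hb
    have hrpos : ∀ (lam : ℝ), lam ≥ 1 → ∀ s : ℝ, 0 < lam ^ s := fun lam hl s =>
      Real.rpow_pos_of_pos (by linarith) _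
    have hc := fun lam (hl : lam ≥ (1 : ℝ)) =>
      quot_smooth (hrpos lam hl (-α)) (hsm lam hl) (hs lam hl)
    have hcd : ∀ lam ≥ (1 : ℝ), ContDiff ℝ (⊤ : ℕ∞) (deriv (fun x : ℝ => a lam x / (x : ℂ))) :=
      fun lam hl => (contDiff_infty_iff_deriv.mp (hc lam hl)).2
    obtain ⟨C, hC, h⟩ := ih (fun lam x => ((((lam ^ α) ^ 2)⁻¹ : ℝ) : ℂ) *
        deriv (fun x : ℝ => a lam x / (x : ℂ)) x)
      (fun lam hl => contDiff_const.mul (hcd lam hl))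
      (fun lam hl x hx => supp_deriv (annS_closed _) (quot_supp (hs lam hl))
        (right_ne_zero_of_mul hx))
      (by
        intro k
        obtain ⟨D, hD, h⟩ := quot_bd α a hsm hs hb (k + 1)
        refine ⟨D, hD, fun lam hl x => ?_⟩
        have h1 := h lam hl x
        have hm := hrpos lam hl α
        rw [iteratedDeriv_const_mul_field, ← iteratedDeriv_succ', norm_mul, Complex.norm_real,
          Real.norm_of_nonneg (by positivity), inv_mul_le_iff₀ (by positivity)]
        refine h1.trans (le_of_eq ?_)
        ring)
    refine ⟨C, hC, fun lam hl => ?_⟩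
    have h1 := h lam hl
    have hm := hrpos lam hl α
    have hl0 : 0 < lam := by linarith
    have e := ibp (L := lam) (hrpos lam hl (-α)) (hsm lam hl) (hs lam hl)
    simp_rw [mul_left_comm _ ((((lam ^ α) ^ 2)⁻¹ : ℝ) : ℂ)] at h1
    rw [integral_const_mul, norm_mul, Complex.norm_real,
      Real.norm_of_nonneg (by positivity), inv_mul_le_iff₀ (by positivity)] at h1
    have e2 := congrArg norm e
    rw [norm_neg, norm_mul] at e2
    have e3 : ‖(2 * Complex.I * lam : ℂ)‖ = 2 * lam := by
      simp [abs_of_pos hl0]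
    rw [e3] at e2
    rw [← e2] at h1
    have e4 : lam ^ (-((N + 1 : ℕ) : ℝ) * (1 - 2 * α)) =
        lam⁻¹ * ((lam ^ α) ^ 2 * lam ^ (-(N : ℝ) * (1 - 2 * α))) := by
      rw [← Real.rpow_mul_natCast hl0.le, ← Real.rpow_neg_one, ← Real.rpow_add hl0,
        ← Real.rpow_add hl0]
      congr 1
      push_cast; ring
    rw [e4]
    set I := ‖∫ x : ℝ, Complex.exp (Complex.I * lam * x ^ 2) * a lam x‖
    have hI : 0 ≤ I := norm_nonneg _
    have : C * (lam⁻¹ * ((lam ^ α) ^ 2 * lam ^ (-(N : ℝ) * (1 - 2 * α)))) =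
      lam⁻¹ * ((lam ^ α) ^ 2 * (C * lam ^ (-(N : ℝ) * (1 - 2 * α)))) := by ring
    rw [this, le_inv_mul_iff₀ hl0]
    nlinarith [mul_nonneg hl0.le hI]

/-- step 2 of the Van der Corput argument of the paper.  If
`a(λ,·)` is smooth, supported in `{λ^{-α} ≤ |x| ≤ 1}` with `0 < α < 1/2`, and
`|∂ₓᵏ a(λ,x)| ≤ C_k λ^{αk}`, then for every `N` the oscillatory integral
`∫ e^{iλx²} a(λ,x) dx` is bounded by `C_N λ^{-N(1-2α)}` uniformly in `λ ≥ 1`. -/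
theorem stmt_10 (α : ℝ) (hα0 : 0 < α) (hα : α < 1 / 2)
    (a : ℝ → ℝ → ℂ)
    (ha_smooth : ∀ lam ≥ (1 : ℝ), ContDiff ℝ (⊤ : ℕ∞) (a lam))
    (ha_supp : ∀ lam ≥ (1 : ℝ),
      Function.support (a lam) ⊆ {x : ℝ | lam ^ (-α) ≤ |x| ∧ |x| ≤ 1})
    (ha_bd : ∀ k : ℕ, ∃ C > 0, ∀ lam ≥ (1 : ℝ), ∀ x : ℝ,
      ‖iteratedDeriv k (a lam) x‖ ≤ C * lam ^ (α * k)) :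
    ∀ N : ℕ, ∃ C_N > 0, ∀ lam ≥ (1 : ℝ),
      ‖∫ x : ℝ, Complex.exp (Complex.I * lam * x ^ 2) * a lam x‖ ≤
        C_N * lam ^ (-(N : ℝ) * (1 - 2 * α)) := by
  intro N
  refine main_aux α N a ha_smooth ha_supp fun k => ?_
  obtain ⟨C, hC, h⟩ := ha_bd k
  refine ⟨C, hC, fun lam hl x => ?_⟩
  rw [← Real.rpow_mul_natCast (by linarith)]
  exact h lam hl x
end
end

section
/- Let λ ≥ 1 and let a(λ,·) : ℝ → ℂ be smooth, supported in [−1, 1], and satisfy |∂ₓ^k a(λ,x)| ≤ C_k λ^{k/2} for every natural number k, with constants C_k independent of λ and x. Then there is a constant C, independent of λ, such that |∫_ℝ e^{iλx²} a(λ,x) dx| ≤ C λ^{-1/2}. -/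
open MeasureTheory Real

noncomputable section

def phP (l : ℝ) (x : ℝ) : ℂ := 1 + 2 * Complex.I * l * x ^ 2

lemma phP_norm (l x : ℝ) (hl : 1 ≤ l) : (1 + l * x ^ 2) / 2 ≤ ‖phP l x‖ := by
  have h0 : 0 ≤ l * x ^ 2 := by positivity
  have h1 : phP l x = ((1 : ℝ) : ℂ) + ((2 * (l * x ^ 2) : ℝ) : ℂ) * Complex.I := by
    unfold phP; push_cast; ring
  rw [h1, Complex.norm_add_mul_I]
  apply Real.le_sqrt_of_sq_le
  nlinarith [sq_nonneg (l * x ^ 2 - 1)]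

lemma phP_ne (l x : ℝ) (hl : 1 ≤ l) : phP l x ≠ 0 := by
  have := phP_norm l x hl
  have h0 : 0 ≤ l * x ^ 2 := by positivity
  intro h
  rw [h, norm_zero] at this
  linarith

lemma phP_inv (l x : ℝ) (hl : 1 ≤ l) : ‖(phP l x)⁻¹‖ ≤ 2 * (1 + l * x ^ 2)⁻¹ := by
  have h0 : 0 ≤ l * x ^ 2 := by positivity
  rw [norm_inv]
  calc _ ≤ ((1 + l * x ^ 2) / 2)⁻¹ := inv_anti₀ (by linarith) (phP_norm l x hl)
    _ = _ := by rw [inv_div]; rfl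

def phR (l : ℝ) (b b1 b2 : ℝ → ℂ) (x : ℝ) : ℂ :=
  4 * Complex.I * l * x ^ 2 * b x * (phP l x)⁻¹ ^ 2
    + (x * (phP l x)⁻¹ ^ 2 - 8 * Complex.I * l * x ^ 3 * (phP l x)⁻¹ ^ 3) * b1 x
    + x ^ 2 * b2 x * (phP l x)⁻¹ ^ 2

lemma ph_deriv (l : ℝ) (hl : 1 ≤ l) (b b1 b2 : ℝ → ℂ) (x : ℝ)
    (h1 : HasDerivAt b (b1 x) x) (h2 : HasDerivAt b1 (b2 x) x) :
    HasDerivAt (fun x : ℝ => Complex.exp (Complex.I * l * x ^ 2) *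
        (x * b x * (phP l x)⁻¹ - x ^ 2 * b1 x * (phP l x)⁻¹ ^ 2))
      (Complex.exp (Complex.I * l * x ^ 2) * b x
        - Complex.exp (Complex.I * l * x ^ 2) * phR l b b1 b2 x) x := by
  have hx : HasDerivAt (fun x : ℝ => (x : ℂ)) 1 x := Complex.ofRealCLM.hasDerivAt
  have he := ((hx.pow 2).const_mul (Complex.I * l)).cexp
  have hp : HasDerivAt (fun x : ℝ => phP l x) (2 * Complex.I * l * (2 * x)) x := by
    have := ((hx.pow 2).const_mul (2 * Complex.I * l)).const_add 1
    refine this.congr_deriv ?_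
    simp
  have hq := hp.inv (phP_ne l x hl)
  have := he.mul (((hx.mul h1).mul hq).sub (((hx.pow 2).mul h2).mul (hq.pow 2)))
  refine this.congr_deriv ?_
  have hn := phP_ne l x hl
  have hpe : phP l x = 1 + 2 * Complex.I * l * x ^ 2 := rfl
  simp only [phR, Pi.mul_apply, Pi.pow_apply, Pi.sub_apply, Pi.inv_apply, Nat.reduceSub, pow_one]
  generalize Complex.exp (Complex.I * l * x ^ 2) = E
  have key : 2 * Complex.I * l * x ^ 2 = phP l x - 1 := by rw [hpe]; ring
  generalize phP l x = p at *
  field_simp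
  have key2 : p = 1 + 2 * Complex.I * l * x ^ 2 := by rw [key]; ring
  subst key2
  push_cast
  ring

lemma phR_bound (l : ℝ) (hl : 1 ≤ l) (b b1 b2 : ℝ → ℂ) (A B C : ℝ) (x : ℝ)
    (h0 : ‖b x‖ ≤ A) (h1 : ‖b1 x‖ ≤ B * √l) (h2 : ‖b2 x‖ ≤ C * l) (hA : 0 < A) (hB : 0 < B)
    (hC : 0 < C) :
    ‖phR l b b1 b2 x‖ ≤ (16 * A + 68 * B + 4 * C) * (1 + (√l * x) ^ 2)⁻¹ := by
  have hP := phP_inv l x hl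
  obtain ⟨r, hr, hrl⟩ : ∃ r : ℝ, 0 ≤ r ∧ √l = r := ⟨_, Real.sqrt_nonneg l, rfl⟩
  have hl2 : l = r ^ 2 := by rw [← hrl, Real.sq_sqrt (by linarith)]
  have hlx : l * x ^ 2 = (r * |x|) ^ 2 := by rw [hl2, mul_pow, sq_abs]
  have hlx' : (r * x) ^ 2 = (r * |x|) ^ 2 := by rw [mul_pow, mul_pow, sq_abs]
  rw [hrl] at h1 ⊢
  rw [hlx] at hP
  rw [hlx']
  have hn2 : ‖(phP l x)⁻¹ ^ 2‖ ≤ 4 * (1 + (r * |x|) ^ 2)⁻¹ ^ 2 := by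
    rw [norm_pow]
    calc _ ≤ (2 * (1 + (r * |x|) ^ 2)⁻¹) ^ 2 := by gcongr
      _ = _ := by ring
  have hn3 : ‖(phP l x)⁻¹ ^ 3‖ ≤ 8 * (1 + (r * |x|) ^ 2)⁻¹ ^ 3 := by
    rw [norm_pow]
    calc _ ≤ (2 * (1 + (r * |x|) ^ 2)⁻¹) ^ 3 := by gcongr
      _ = _ := by ring
  have hl0 : |l| = r ^ 2 := by rw [abs_of_nonneg (by linarith), hl2]
  have hs0 : 0 ≤ r * |x| := by positivity
  set s := r * |x| with hs
  have hq : (0:ℝ) < 1 + s ^ 2 := by positivity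
  have e1 : s ^ 2 * (1 + s ^ 2)⁻¹ ^ 2 ≤ (1 + s ^ 2)⁻¹ := by
    field_simp; nlinarith
  have e2 : s * (1 + s ^ 2)⁻¹ ^ 2 ≤ (1 + s ^ 2)⁻¹ := by
    field_simp; nlinarith [sq_nonneg (s - 1)]
  have e3 : s ^ 3 * (1 + s ^ 2)⁻¹ ^ 3 ≤ (1 + s ^ 2)⁻¹ := by
    field_simp; nlinarith [sq_nonneg (s - 1), mul_nonneg (sq_nonneg s) (sq_nonneg (s - 1)), pow_nonneg hs0 3]
  generalize (1 + s ^ 2)⁻¹ = q at *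
  have hq0 : 0 ≤ q := le_trans (by positivity) e1
  have t1 : ‖4 * Complex.I * l * x ^ 2 * b x * (phP l x)⁻¹ ^ 2‖ ≤ 16 * A * q := by
    rw [norm_mul, norm_mul]
    have : ‖4 * Complex.I * l * (x : ℂ) ^ 2‖ = 4 * s ^ 2 := by
      simp [hl0, hs, mul_pow]; ring
    rw [this]
    calc _ ≤ 4 * s ^ 2 * A * (4 * q ^ 2) := by gcongr
      _ = 16 * A * (s ^ 2 * q ^ 2) := by ring
      _ ≤ _ := by gcongr
  have t2 : ‖x * (phP l x)⁻¹ ^ 2 * b1 x‖ ≤ 4 * B * q := by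
    rw [norm_mul, norm_mul]
    have : ‖(x : ℂ)‖ = |x| := by simp
    rw [this]
    calc _ ≤ |x| * (4 * q ^ 2) * (B * r) := by gcongr
      _ = 4 * B * (s * q ^ 2) := by rw [hs]; ring
      _ ≤ _ := by gcongr
  have t3 : ‖8 * Complex.I * l * x ^ 3 * (phP l x)⁻¹ ^ 3 * b1 x‖ ≤ 64 * B * q := by
    rw [norm_mul, norm_mul]
    have : ‖8 * Complex.I * l * (x : ℂ) ^ 3‖ = 8 * r ^ 2 * |x| ^ 3 := by
      simp [hl0]
    rw [this]
    calc _ ≤ 8 * r ^ 2 * |x| ^ 3 * (8 * q ^ 3) * (B * r) := by gcongr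
      _ = 64 * B * (s ^ 3 * q ^ 3) := by rw [hs]; ring
      _ ≤ _ := by gcongr
  have t4 : ‖x ^ 2 * b2 x * (phP l x)⁻¹ ^ 2‖ ≤ 4 * C * q := by
    rw [norm_mul, norm_mul]
    have : ‖(x : ℂ) ^ 2‖ = |x| ^ 2 := by simp
    rw [this]
    rw [hl2] at h2
    calc _ ≤ |x| ^ 2 * (C * r ^ 2) * (4 * q ^ 2) := by gcongr
      _ = 4 * C * (s ^ 2 * q ^ 2) := by rw [hs]; ring
      _ ≤ _ := by gcongr
  unfold phR
  rw [sub_mul]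
  refine (norm_add_le _ _).trans ?_
  have u1 := norm_add_le (4 * Complex.I * l * x ^ 2 * b x * (phP l x)⁻¹ ^ 2)
    (x * (phP l x)⁻¹ ^ 2 * b1 x - 8 * Complex.I * l * x ^ 3 * (phP l x)⁻¹ ^ 3 * b1 x)
  have u2 := norm_sub_le (x * (phP l x)⁻¹ ^ 2 * b1 x)
    (8 * Complex.I * l * x ^ 3 * (phP l x)⁻¹ ^ 3 * b1 x)
  linarith

lemma ph_main (l : ℝ) (hl : 1 ≤ l) (b : ℝ → ℂ) (hb : ContDiff ℝ (⊤ : ℕ∞) b)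
    (hs : Function.support b ⊆ Set.Icc (-1 : ℝ) 1) (A B C : ℝ)
    (h0 : ∀ x, ‖b x‖ ≤ A) (h1 : ∀ x, ‖deriv b x‖ ≤ B * √l)
    (h2 : ∀ x, ‖deriv (deriv b) x‖ ≤ C * l) (hA : 0 < A) (hB : 0 < B) (hC : 0 < C) :
    ‖∫ x : ℝ, Complex.exp (Complex.I * l * x ^ 2) * b x‖ ≤
      (16 * A + 68 * B + 4 * C) * π * (√l)⁻¹ := by
  have hb1 : ContDiff ℝ (⊤ : ℕ∞) (deriv b) := (contDiff_infty_iff_deriv.mp hb).2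
  have hb2 : ContDiff ℝ (⊤ : ℕ∞) (deriv (deriv b)) := (contDiff_infty_iff_deriv.mp hb1).2
  have c0 := hb.continuous
  have c1 := hb1.continuous
  have c2 := hb2.continuous
  have s0 : HasCompactSupport b := HasCompactSupport.of_support_subset_isCompact isCompact_Icc hs
  have s1 := s0.deriv
  have s2 := s1.deriv
  have cP : Continuous (fun x => (phP l x)⁻¹) := by
    refine Continuous.inv₀ ?_ (fun x => phP_ne l x hl)
    unfold phP; fun_prop
  have cR : Continuous (phR l b (deriv b) (deriv (deriv b))) := by
    unfold phR; fun_prop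
  have sR : HasCompactSupport (phR l b (deriv b) (deriv (deriv b))) := by
    unfold phR
    exact ((s0.mul_left.mul_right).add s1.mul_left).add s2.mul_left.mul_right
  have i1 : Integrable (fun x : ℝ => Complex.exp (Complex.I * l * x ^ 2) * b x) :=
    Continuous.integrable_of_hasCompactSupport (by fun_prop) s0.mul_left
  have i2 : Integrable (fun x : ℝ => Complex.exp (Complex.I * l * x ^ 2) *
      phR l b (deriv b) (deriv (deriv b)) x) :=
    Continuous.integrable_of_hasCompactSupport (by fun_prop) sR.mul_left
  have i3 : Integrable (fun x : ℝ => Complex.exp (Complex.I * l * x ^ 2) *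
        (x * b x * (phP l x)⁻¹ - x ^ 2 * deriv b x * (phP l x)⁻¹ ^ 2)) := by
    refine Continuous.integrable_of_hasCompactSupport (by fun_prop) ?_
    exact HasCompactSupport.mul_left (s0.mul_left.mul_right.sub s1.mul_left.mul_right)
  have hz := integral_eq_zero_of_hasDerivAt_of_integrable (fun x => ph_deriv l hl b (deriv b)
    (deriv (deriv b)) x ((hb.differentiable (by simp)) x).hasDerivAt
    ((hb1.differentiable (by simp)) x).hasDerivAt) (i1.sub i2) i3
  rw [integral_sub i1 i2, sub_eq_zero] at hz
  rw [hz]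
  have hr : 0 < √l := Real.sqrt_pos.mpr (by linarith)
  have hint : Integrable (fun x : ℝ => (16 * A + 68 * B + 4 * C) * (1 + (√l * x) ^ 2)⁻¹) :=
    (integrable_inv_one_add_sq.comp_mul_left' hr.ne').const_mul _
  refine (norm_integral_le_of_norm_le hint (Filter.Eventually.of_forall fun x => ?_)).trans ?_
  · have : ‖Complex.exp (Complex.I * l * x ^ 2)‖ = 1 := by
      rw [Complex.norm_exp]
      have : Complex.I * l * x ^ 2 = ((l * x ^ 2 : ℝ) : ℂ) * Complex.I := by push_cast; ring
      rw [this]; simp [-Complex.ofReal_mul, -Complex.ofReal_pow]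
    rw [norm_mul, this, one_mul]
    exact phR_bound l hl b _ _ A B C x (h0 x) (h1 x) (h2 x) hA hB hC
  · rw [integral_const_mul, Measure.integral_comp_mul_left (fun y : ℝ => (1 + y ^ 2)⁻¹),
      integral_univ_inv_one_add_sq, abs_of_pos (by positivity), smul_eq_mul]
    apply le_of_eq; ring

/-- Van der Corput lemma with symbols of regularity loss `λ^{1/2}` per
derivative, as discussed in the paper.  If `a(λ,·)` is smooth, supported in `[-1,1]`,
with `|∂ₓᵏ a(λ,x)| ≤ C_k λ^{k/2}` uniformly in `λ ≥ 1` and `x`, then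
`|∫ e^{iλx²} a(λ,x) dx| ≤ C λ^{-1/2}` with `C` independent of `λ`. -/
theorem stmt_11 (a : ℝ → ℝ → ℂ)
    (ha_smooth : ∀ lam ≥ (1 : ℝ), ContDiff ℝ (⊤ : ℕ∞) (a lam))
    (ha_supp : ∀ lam ≥ (1 : ℝ), Function.support (a lam) ⊆ Set.Icc (-1 : ℝ) 1)
    (ha_bd : ∀ k : ℕ, ∃ C > 0, ∀ lam ≥ (1 : ℝ), ∀ x : ℝ,
      ‖iteratedDeriv k (a lam) x‖ ≤ C * lam ^ ((k : ℝ) / 2)) :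
    ∃ C > 0, ∀ lam ≥ (1 : ℝ),
      ‖∫ x : ℝ, Complex.exp (Complex.I * lam * x ^ 2) * a lam x‖ ≤
        C * lam ^ (-(1 : ℝ) / 2) := by
  obtain ⟨A, hA, h0⟩ := ha_bd 0
  obtain ⟨B, hB, h1⟩ := ha_bd 1
  obtain ⟨C, hC, h2⟩ := ha_bd 2
  refine ⟨(16 * A + 68 * B + 4 * C) * π, by positivity, fun l hl => ?_⟩
  have hl0 : (0 : ℝ) ≤ l := by linarith
  have := ph_main l hl (a l) (ha_smooth l hl) (ha_supp l hl) A B C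
    (fun x => by simpa using h0 l hl x)
    (fun x => by simpa [Real.sqrt_eq_rpow] using h1 l hl x)
    (fun x => by simpa [iteratedDeriv_succ] using h2 l hl x) hA hB hC
  rwa [Real.sqrt_eq_rpow, ← Real.rpow_neg hl0, ← neg_div] at this
end
end
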